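/- Let G be the semidirect product of the additive group ℤ/8ℤ by the multiplicative group (ℤ/8ℤ)* = {1,3,5,7} acting by multiplication, i.e., the group of pairs (a,b) ∈ (ℤ/8ℤ)* × ℤ/8ℤ with multiplication (a,b)·(c,d) = (ac, b + ad). Let H₁ = {(a,0) : a ∈ (ℤ/8ℤ)*} and H₂ = {(1,0), (3,4), (5,4), (7,0)}. Then H₂ is a subgroup of G, and for every g ∈ G the conjugacy class [g] of g in G satisfies |[g] ∩ H₁| = |[g] ∩ H₂|. -/

import Mathlib

/-- The group of pairs `(a, b) ∈ (ℤ/8ℤ)* × ℤ/8ℤ` with multiplication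
`(a,b)·(c,d) = (ac, b + ad)`, i.e. the semidirect product `ℤ/8ℤ ⋊ (ℤ/8ℤ)*`. -/
@[ext] structure G8 : Type where
  a : (ZMod 8)ˣ
  b : ZMod 8
deriving DecidableEq

instance : Fintype G8 :=
  Fintype.ofEquiv ((ZMod 8)ˣ × ZMod 8)
    { toFun := fun _q => ⟨_q.1, _q.2⟩
      invFun := fun h => (h.a, h.b)
      left_inv := fun _q => rfl
      right_inv := fun _ => rfl }

instance : Mul G8 := ⟨fun x y => ⟨x.a * y.a, x.b + (x.a : ZMod 8) * y.b⟩⟩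
instance : One G8 := ⟨⟨1, 0⟩⟩
instance : Inv G8 := ⟨fun x => ⟨x.a⁻¹, -(((x.a⁻¹ : (ZMod 8)ˣ) : ZMod 8) * x.b)⟩⟩

lemma G8.mul_def (x y : G8) : x * y = ⟨x.a * y.a, x.b + (x.a : ZMod 8) * y.b⟩ := rfl
lemma G8.one_def : (1 : G8) = ⟨1, 0⟩ := rfl
lemma G8.inv_def (x : G8) : x⁻¹ = ⟨x.a⁻¹, -(((x.a⁻¹ : (ZMod 8)ˣ) : ZMod 8) * x.b)⟩ := rfl

instance : Group G8 where
  mul_assoc x y z := by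
    simp only [G8.mul_def]
    ext <;> simp [mul_assoc, mul_add, Units.val_mul, add_assoc]
  one_mul x := by
    simp only [G8.mul_def, G8.one_def]
    ext <;> simp
  mul_one x := by
    simp only [G8.mul_def, G8.one_def]
    ext <;> simp
  inv_mul_cancel x := by
    simp only [G8.mul_def, G8.inv_def, G8.one_def]
    ext <;> simp

/-- The unit `3` of `ℤ/8ℤ` (self-inverse since `3² = 9 = 1`). -/
def u3 : (ZMod 8)ˣ := ⟨3, 3, by decide, by decide⟩
/-- The unit `5` of `ℤ/8ℤ`. -/
def u5 : (ZMod 8)ˣ := ⟨5, 5, by decide, by decide⟩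
/-- The unit `7` of `ℤ/8ℤ`. -/
def u7 : (ZMod 8)ˣ := ⟨7, 7, by decide, by decide⟩

/-- The subgroup `H₁ = {(a, 0)}` of `G8`, as a set. -/
def H1set : Set G8 := {g : G8 | g.b = 0}

/-- The set `H₂ = {(1,0), (3,4), (5,4), (7,0)}` in `G8`. -/
def H2set : Set G8 := {⟨1, 0⟩, ⟨u3, 4⟩, ⟨u5, 4⟩, ⟨u7, 0⟩}

/-- The conjugacy class of `g` in `G8`. -/
def conjClass (g : G8) : Set G8 := {y : G8 | ∃ x : G8, x * g * x⁻¹ = y}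

/-- The second-coordinate shift carrying `H₁` to `H₂`. -/
def shiftB (a : (ZMod 8)ˣ) : ZMod 8 := if a = u3 ∨ a = u5 then 4 else 0

/-- A bijection of `G8` carrying `H₁` to `H₂` and preserving conjugacy on `H₁`. -/
def phi (x : G8) : G8 := ⟨x.a, x.b + shiftB x.a⟩

lemma phi_injective : Function.Injective phi := by
  rintro ⟨a, b⟩ ⟨c, d⟩ h
  simp only [phi, G8.mk.injEq] at h
  obtain ⟨rfl, h⟩ := h
  simpa using h

lemma units_cases : ∀ a : (ZMod 8)ˣ, a = 1 ∨ a = u3 ∨ a = u5 ∨ a = u7 := by decide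

lemma mem_H2set_iff (x : G8) : x ∈ H2set ↔ x.b = shiftB x.a := by
  obtain ⟨a, b⟩ := x
  simp only [H2set, Set.mem_insert_iff, Set.mem_singleton_iff, G8.mk.injEq]
  revert a b
  decide

lemma shiftB_mul : ∀ a c : (ZMod 8)ˣ, shiftB (a * c) = shiftB a + a * shiftB c := by decide

lemma shiftB_inv : ∀ a : (ZMod 8)ˣ, shiftB a⁻¹ = -(((a⁻¹ : (ZMod 8)ˣ) : ZMod 8) * shiftB a) := by
  decide

/-- `shiftB` is a coboundary on each element. -/
lemma exists_shift : ∀ a : (ZMod 8)ˣ, ∃ t : ZMod 8, t - a * t = shiftB a := by decide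

lemma phi_conj (x : G8) (hx : x.b = 0) : ∃ y : G8, y * x * y⁻¹ = phi x := by
  obtain ⟨t, ht⟩ := exists_shift x.a
  refine ⟨⟨1, t⟩, ?_⟩
  ext <;> simp [G8.mul_def, G8.inv_def, phi, hx, ← ht, sub_eq_add_neg]

lemma conjClass_phi (g x : G8) (hx : x.b = 0) : phi x ∈ conjClass g ↔ x ∈ conjClass g := by
  obtain ⟨y, hy⟩ := phi_conj x hx
  constructor
  · rintro ⟨z, hz⟩
    refine ⟨y⁻¹ * z, ?_⟩
    have : x = y⁻¹ * (z * g * z⁻¹) * y := by rw [hz, ← hy]; group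
    rw [this]; group
  · rintro ⟨z, hz⟩
    refine ⟨y * z, ?_⟩
    rw [← hy, ← hz]; group

/-- **The Gassmann–Sunada triple of Section 5.** In the group `G8` of pairs
`(a,b) ∈ (ℤ/8ℤ)* × ℤ/8ℤ` with `(a,b)·(c,d) = (ac, b+ad)`, the set
`H₂ = {(1,0), (3,4), (5,4), (7,0)}` is a subgroup, and for every `g` the conjugacy class
`[g]` meets `H₁ = {(a,0)}` and `H₂` in the same number of elements. -/
theorem stmt14 :
    (∃ H₂' : Subgroup G8, (H₂' : Set G8) = H2set) ∧
    ∀ g : G8, Nat.card (conjClass g ∩ H1set : Set G8) =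
      Nat.card (conjClass g ∩ H2set : Set G8) := by
  constructor
  · refine ⟨{ carrier := H2set, mul_mem' := ?_, one_mem' := ?_, inv_mem' := ?_ }, rfl⟩
    · intro x y hx hy
      rw [mem_H2set_iff] at *
      simp only [G8.mul_def, shiftB_mul, hx, hy]
    · rw [mem_H2set_iff]; decide
    · intro x hx
      rw [mem_H2set_iff] at *
      simp only [G8.inv_def, shiftB_inv, hx]
  · intro g
    have key : conjClass g ∩ H2set = phi '' (conjClass g ∩ H1set) := by
      ext y
      constructor
      · rintro ⟨h1, h2⟩
        rw [mem_H2set_iff] at h2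
        have e : phi ⟨y.a, 0⟩ = y := by ext <;> simp [phi, h2]
        exact ⟨⟨y.a, 0⟩, ⟨(conjClass_phi g _ rfl).1 (e.symm ▸ h1), rfl⟩, e⟩
      · rintro ⟨x, ⟨h1, h2⟩, rfl⟩
        have h2' : x.b = 0 := h2
        refine ⟨(conjClass_phi g x h2').2 h1, ?_⟩
        rw [mem_H2set_iff]
        simp [phi, h2']
    rw [key, Nat.card_image_of_injective phi_injective]
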